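/- arXiv:2304.00895 — 4 statements merged into one kernel-verified Lean document; each statement's English description precedes it below -/
import Mathlib

section
/- For every natural number n, the (n+3)-rd Dedekind number satisfies the dual formula d (n+3) = ∑_{(x,y) : D n × D n, x ≤ y} ∑_{a,b,c ∈ Set.Icc x y} Nat.card (Set.Icc x (a ⊓ b)) · Nat.card (Set.Icc x (a ⊓ c)) · Nat.card (Set.Icc x (b ⊓ c)), where the outer sum ranges over all intervals [x, y] of D n and the inner sum over all triples (a, b, c) of elements of the interval. -/
/-- `D n`: the monotone Boolean functions in `n` variables, i.e. the free
distributive lattice (with bounds) on `n` generators. -/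
def D (n : ℕ) : Type := {f : (Fin n → Bool) → Bool // Monotone f}

namespace D

noncomputable instance instLattice (n : ℕ) : Lattice (D n) :=
  Subtype.lattice (fun _ _ hf hg => hf.sup hg) (fun _ _ hf hg => hf.inf hg)

instance (n : ℕ) : DecidablePred (Monotone : ((Fin n → Bool) → Bool) → Prop) :=
  fun f => decidable_of_iff (∀ a b : Fin n → Bool, (∀ i, a i ≤ b i) → f a ≤ f b)
    (by constructor
        · intro h a b hab; exact h a b hab
        · intro h a b hab; exact h hab)

instance instFintype (n : ℕ) : Fintype (D n) := Subtype.fintype _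

instance instBoundedOrder (n : ℕ) : BoundedOrder (D n) where
  top := ⟨fun _ => true, monotone_const⟩
  le_top _ := fun _ => Bool.le_true _
  bot := ⟨fun _ => false, monotone_const⟩
  bot_le _ := fun _ => Bool.false_le _

noncomputable instance (n : ℕ) (s : Set (D n)) : Fintype s := Fintype.ofFinite _

end D

/-- The `n`-th Dedekind number. -/
noncomputable def d (n : ℕ) : ℕ := Fintype.card (D n)

noncomputable instance (n : ℕ) : Fintype {p : D n × D n // p.1 ≤ p.2} :=
  Fintype.ofFinite _

instance (n : ℕ) : DecidableEq (D n) :=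
  fun a b => decidable_of_iff (a.val = b.val) Subtype.val_inj

def MF (n : ℕ) : Type := {F : Bool → Bool → Bool → D n //
  ∀ u u' v v' w w', u ≤ u' → v ≤ v' → w ≤ w' → F u v w ≤ F u' v' w'}

def sliceEquiv (n : ℕ) : D (n + 3) ≃ MF n where
  toFun f := ⟨fun u v w => ⟨fun g => f.1 (Fin.cons u (Fin.cons v (Fin.cons w g : Fin (n+1) → Bool) : Fin (n+2) → Bool) : Fin (n+3) → Bool),
      fun g g' h => f.2 (Fin.cons_le_cons.2 ⟨le_rfl, Fin.cons_le_cons.2 ⟨le_rfl, Fin.cons_le_cons.2 ⟨le_rfl, h⟩⟩⟩)⟩,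
    fun u u' v v' w w' hu hv hw g =>
      f.2 (Fin.cons_le_cons.2 ⟨hu, Fin.cons_le_cons.2 ⟨hv, Fin.cons_le_cons.2 ⟨hw, le_rfl⟩⟩⟩)⟩
  invFun F := ⟨fun x => (F.1 (x 0) (x (Fin.succ 0)) (x (Fin.succ (Fin.succ 0)))).1
      (fun i => x i.succ.succ.succ),
    fun x x' h => le_trans ((F.1 _ _ _).2 (fun i => h _))
      (F.2 _ _ _ _ _ _ (h _) (h _) (h _) _)⟩
  left_inv f := by
    apply Subtype.ext
    funext x
    refine congrArg f.1 ?_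
    funext i
    refine Fin.cases rfl (fun i => ?_) i
    refine Fin.cases rfl (fun i => ?_) i
    refine Fin.cases rfl (fun i => ?_) i
    rfl
  right_inv F := by
    apply Subtype.ext
    funext u v w
    rfl

def mk8 {α : Type} (x r s t a b c y : α) : Bool → Bool → Bool → α
  | false, false, false => x
  | true, false, false => r
  | false, true, false => s
  | false, false, true => t
  | true, true, false => a
  | true, false, true => b
  | false, true, true => c
  | true, true, true => y

theorem mk8_mono {α : Type} [Preorder α] {x r s t a b c y : α}
    (h1 : x ≤ r) (h2 : x ≤ s) (h3 : x ≤ t) (h4 : r ≤ a) (h5 : r ≤ b) (h6 : s ≤ a) (h7 : s ≤ c)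
    (h8 : t ≤ b) (h9 : t ≤ c) (h10 : a ≤ y) (h11 : b ≤ y) (h12 : c ≤ y)
    (u u' v v' w w' : Bool) (hu : u ≤ u') (hv : v ≤ v') (hw : w ≤ w') :
    mk8 x r s t a b c y u v w ≤ mk8 x r s t a b c y u' v' w' := by
  have := h1.trans h4
  have := h1.trans h5
  have := h2.trans h7
  have := h4.trans h10
  have := h6.trans h10
  have := h8.trans h11
  have := (h1.trans h4).trans h10
  revert hu hv hw
  cases u <;> cases u' <;> cases v <;> cases v' <;> cases w <;> cases w' <;>
    simp [mk8, *]

def sigEquiv (n : ℕ) : MF n ≃ (Σ p : {p : D n × D n // p.1 ≤ p.2},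
      Σ a : Set.Icc p.val.1 p.val.2, Σ b : Set.Icc p.val.1 p.val.2,
      Σ c : Set.Icc p.val.1 p.val.2,
        (Set.Icc p.val.1 ((a : D n) ⊓ b) × Set.Icc p.val.1 ((a : D n) ⊓ c)) ×
          Set.Icc p.val.1 ((b : D n) ⊓ c)) where
  toFun F :=
    have H : ∀ u u' v v' w w', u ≤ u' → v ≤ v' → w ≤ w' → F.1 u v w ≤ F.1 u' v' w' := F.2
    ⟨⟨(F.1 false false false, F.1 true true true), by apply H <;> decide⟩,
     ⟨F.1 true true false, by constructor <;> apply H <;> decide⟩,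
     ⟨F.1 true false true, by constructor <;> apply H <;> decide⟩,
     ⟨F.1 false true true, by constructor <;> apply H <;> decide⟩,
     (⟨F.1 true false false, by
        refine ⟨?_, le_inf ?_ ?_⟩ <;> apply H <;> decide⟩,
      ⟨F.1 false true false, by
        refine ⟨?_, le_inf ?_ ?_⟩ <;> apply H <;> decide⟩),
      ⟨F.1 false false true, by
        refine ⟨?_, le_inf ?_ ?_⟩ <;> apply H <;> decide⟩⟩
  invFun q := ⟨mk8 q.1.1.1 q.2.2.2.2.1.1.1 q.2.2.2.2.1.2.1 q.2.2.2.2.2.1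
      q.2.1.1 q.2.2.1.1 q.2.2.2.1.1 q.1.1.2, by
    obtain ⟨⟨⟨x, y⟩, hxy⟩, ⟨a, ha⟩, ⟨b, hb⟩, ⟨c, hc⟩, ⟨⟨r, hr⟩, ⟨s, hs⟩⟩, ⟨t, ht⟩⟩ := q
    exact mk8_mono hr.1 hs.1 ht.1 (hr.2.trans inf_le_left) (hr.2.trans inf_le_right)
      (hs.2.trans inf_le_left) (hs.2.trans inf_le_right)
      (ht.2.trans inf_le_left) (ht.2.trans inf_le_right) ha.2 hb.2 hc.2⟩
  left_inv F := by
    apply Subtype.ext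
    funext u v w
    cases u <;> cases v <;> cases w <;> rfl
  right_inv q := rfl

theorem dedekind_plus_three_intervals_dual (n : ℕ) :
    d (n + 3) =
      ∑ p : {p : D n × D n // p.1 ≤ p.2},
        ∑ a : Set.Icc p.val.1 p.val.2, ∑ b : Set.Icc p.val.1 p.val.2, ∑ c : Set.Icc p.val.1 p.val.2,
          Nat.card (Set.Icc p.val.1 ((a : D n) ⊓ b)) *
          Nat.card (Set.Icc p.val.1 ((a : D n) ⊓ c)) *
          Nat.card (Set.Icc p.val.1 ((b : D n) ⊓ c)) := by
  have h := Nat.card_congr ((sliceEquiv n).trans (sigEquiv n))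
  rw [d, ← Nat.card_eq_fintype_card, h]
  simp only [Nat.card_sigma, Nat.card_prod]
end

section
/- For every natural number n, the (n+3)-rd Dedekind number satisfies d (n+3) = ∑_{(x,y) : D n × D n, x ≤ y} ∑_{a,b ∈ Set.Icc x y} ( ∑_{c ∈ Set.Icc a y} Nat.card (Set.Icc x (b ⊓ c)) )², where the outer sum ranges over all intervals [x, y] of D n, a and b range over the interval [x, y], and c ranges over [a, y]. -/
abbrev Cube (n : ℕ) : Type :=
  {t : Bool → Bool → Bool → D n //
    ∀ i j k i' j' k', i ≤ i' → j ≤ j' → k ≤ k' → t i j k ≤ t i' j' k'}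

def cubeEquiv (n : ℕ) : D (n + 3) ≃ Cube n where
  toFun f := ⟨fun i j k => ⟨fun v => f.1 (Fin.cons i (Fin.cons j (Fin.cons k v))), by
      intro v w h
      apply f.2
      intro m
      refine Fin.cases ?_ (fun m => ?_) m
      · simp
      refine Fin.cases ?_ (fun m => ?_) m
      · simp
      refine Fin.cases ?_ (fun m => ?_) m
      · exact le_refl k
      exact h m⟩, by
    intro i j k i' j' k' hi hj hk v
    apply f.2
    intro m
    refine Fin.cases ?_ (fun m => ?_) m
    · exact hi
    refine Fin.cases ?_ (fun m => ?_) m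
    · exact hj
    refine Fin.cases ?_ (fun m => ?_) m
    · exact hk
    simp⟩
  invFun t := ⟨fun v => (t.1 (v 0) (v (Fin.succ 0)) (v (Fin.succ (Fin.succ 0)))).1
      (fun m => v m.succ.succ.succ), by
    intro v w h
    exact le_trans ((t.1 _ _ _).2 (fun m => h m.succ.succ.succ))
      (t.2 _ _ _ _ _ _ (h _) (h _) (h _) _)⟩
  left_inv f := by
    apply Subtype.ext
    funext v
    show f.1 _ = f.1 v
    refine congrArg f.1 ?_
    funext m
    refine Fin.cases ?_ (fun m => ?_) m
    · rfl
    refine Fin.cases ?_ (fun m => ?_) m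
    · rfl
    refine Fin.cases ?_ (fun m => ?_) m
    · rfl
    rfl
  right_inv t := by
    apply Subtype.ext
    funext i j k
    rfl

abbrev Half {n : ℕ} (x y a b : D n) : Type :=
  Σ c : Set.Icc a y, Set.Icc x (b ⊓ (c : D n))

abbrev Tup (n : ℕ) : Type :=
  Σ p : {p : D n × D n // p.1 ≤ p.2},
    Σ a : Set.Icc p.val.1 p.val.2, Σ b : Set.Icc p.val.1 p.val.2,
      Half p.val.1 p.val.2 (a : D n) (b : D n) × Half p.val.1 p.val.2 (a : D n) (b : D n)

def tupFun {n : ℕ} (x y a b c e c' e' : D n) : Bool → Bool → Bool → D n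
  | false, false, false => x
  | true, false, false => a
  | false, true, false => e
  | false, false, true => e'
  | true, true, false => c
  | true, false, true => c'
  | false, true, true => b
  | true, true, true => y

theorem tupFun_mono {n : ℕ} {x y a b c e c' e' : D n} (h1 : x ≤ a) (h2 : b ≤ y)
    (h3 : a ≤ c) (h4 : c ≤ y) (h5 : x ≤ e) (h6 : e ≤ b) (h7 : e ≤ c)
    (h3' : a ≤ c') (h4' : c' ≤ y) (h5' : x ≤ e') (h6' : e' ≤ b) (h7' : e' ≤ c') :
    ∀ i j k i' j' k', i ≤ i' → j ≤ j' → k ≤ k' →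
      tupFun x y a b c e c' e' i j k ≤ tupFun x y a b c e c' e' i' j' k' := by
  have q1 := h1.trans h3
  have q2 := h1.trans h3'
  have q3 := q1.trans h4
  have q4 := h5.trans h6
  have q5 := h3.trans h4
  have q6 := h6.trans h2
  have q7 := h6'.trans h2
  rintro (_ | _) (_ | _) (_ | _) (_ | _) (_ | _) (_ | _) hi hj hk <;>
    first
    | exact absurd hi (by decide)
    | exact absurd hj (by decide)
    | exact absurd hk (by decide)
    | exact le_refl _
    | (simp only [tupFun]; assumption)

def tupEquiv (n : ℕ) : Cube n ≃ Tup n where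
  toFun t :=
    have m : ∀ i j k i' j' k', i ≤ i' → j ≤ j' → k ≤ k' → t.1 i j k ≤ t.1 i' j' k' := t.2
    ⟨⟨(t.1 false false false, t.1 true true true),
        by apply m <;> decide⟩,
      ⟨t.1 true false false, by apply m <;> decide, by apply m <;> decide⟩,
      ⟨t.1 false true true, by apply m <;> decide, by apply m <;> decide⟩,
      ⟨⟨t.1 true true false, by apply m <;> decide, by apply m <;> decide⟩,
        ⟨t.1 false true false, by apply m <;> decide,
          le_inf (by apply m <;> decide) (by apply m <;> decide)⟩⟩,
      ⟨⟨t.1 true false true, by apply m <;> decide, by apply m <;> decide⟩,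
        ⟨t.1 false false true, by apply m <;> decide,
          le_inf (by apply m <;> decide) (by apply m <;> decide)⟩⟩⟩
  invFun s := ⟨tupFun s.1.1.1 s.1.1.2 s.2.1.1 s.2.2.1.1 s.2.2.2.1.1.1 s.2.2.2.1.2.1
      s.2.2.2.2.1.1 s.2.2.2.2.2.1,
    tupFun_mono s.2.1.2.1 s.2.2.1.2.2 s.2.2.2.1.1.2.1 s.2.2.2.1.1.2.2
      s.2.2.2.1.2.2.1 (s.2.2.2.1.2.2.2.trans inf_le_left) (s.2.2.2.1.2.2.2.trans inf_le_right)
      s.2.2.2.2.1.2.1 s.2.2.2.2.1.2.2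
      s.2.2.2.2.2.2.1 (s.2.2.2.2.2.2.2.trans inf_le_left) (s.2.2.2.2.2.2.2.trans inf_le_right)⟩
  left_inv t := by
    apply Subtype.ext
    funext i j k
    cases i <;> cases j <;> cases k <;> rfl
  right_inv s := rfl

theorem dedekind_plus_three_squared (n : ℕ) :
    d (n + 3) =
      ∑ p : {p : D n × D n // p.1 ≤ p.2},
        ∑ a : Set.Icc p.val.1 p.val.2, ∑ b : Set.Icc p.val.1 p.val.2,
          (∑ c : Set.Icc (a : D n) p.val.2,
            Nat.card (Set.Icc p.val.1 ((b : D n) ⊓ c))) ^ 2 := by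
  have h : d (n + 3) = Nat.card (Tup n) := by
    rw [d, ← Nat.card_eq_fintype_card]
    exact Nat.card_congr ((cubeEquiv n).trans (tupEquiv n))
  rw [h]
  simp only [Nat.card_sigma, Nat.card_prod, sq]
end

section
/- For every natural number n, the (n+3)-rd Dedekind number can be computed by traces of matrix cubes: d (n+3) = ∑_{(x,y) : D n × D n, x ≤ y} Matrix.trace (α_{x,y} ^ 3), where for each interval [x, y] of D n, α_{x,y} is the square matrix with rows and columns indexed by the elements of Set.Icc x y and natural-number entries α_{x,y} a b = Nat.card (Set.Icc (a ⊔ b) y). -/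
namespace D

theorem cons_mono {n : ℕ} {b c : Bool} {x y : Fin n → Bool} (h : b ≤ c) (hxy : x ≤ y) :
    (Fin.cons b x : Fin (n+1) → Bool) ≤ (Fin.cons c y : Fin (n+1) → Bool) := by
  intro i
  refine Fin.cases ?_ (fun j => ?_) i
  · exact h
  · exact hxy j

def cut {n : ℕ} (b : Bool) (f : D (n+1)) : D n :=
  ⟨fun x => f.val (Fin.cons b x : Fin (n+1) → Bool), fun _ _ h => f.2 (cons_mono le_rfl h)⟩

theorem cut_le {n : ℕ} (f : D (n+1)) : cut false f ≤ cut true f :=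
  fun _ => f.2 (cons_mono (Bool.false_le _) le_rfl)

theorem cut_mono {n : ℕ} (b : Bool) {f g : D (n+1)} (h : f ≤ g) : cut b f ≤ cut b g :=
  fun _ => h _

def glue {n : ℕ} (u v : D n) (h : u ≤ v) : D (n+1) :=
  ⟨fun x => cond (x 0) (v.val (fun i => x i.succ)) (u.val (fun i => x i.succ)), by
    intro x y hxy
    have h0 := hxy 0
    have ht : (fun i : Fin n => x i.succ) ≤ (fun i : Fin n => y i.succ) := fun i => hxy i.succ
    show cond (x 0) _ _ ≤ cond (y 0) _ _
    cases hx : x 0 <;> cases hy : y 0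
    · exact u.2 ht
    · exact (u.2 ht).trans (h _)
    · rw [hx, hy] at h0; exact absurd (h0 rfl) Bool.false_ne_true
    · exact v.2 ht⟩

theorem glue_mono {n : ℕ} {u v u' v' : D n} {h : u ≤ v} {h' : u' ≤ v'} (hu : u ≤ u')
    (hv : v ≤ v') : glue u v h ≤ glue u' v' h' := by
  intro x
  show cond (x 0) _ _ ≤ cond (x 0) _ _
  cases x 0
  · exact hu _
  · exact hv _

theorem glue_cut {n : ℕ} (f : D (n+1)) (h) : glue (cut false f) (cut true f) h = f := by
  apply Subtype.ext
  funext x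
  have : x = (Fin.cons (x 0) (fun i => x i.succ) : Fin (n+1) → Bool) := (Fin.cons_self_tail x).symm
  show cond (x 0) (f.val _) (f.val _) = f.val x
  conv_rhs => rw [this]
  cases x 0 <;> rfl

theorem glue_eq {n : ℕ} {f : D (n+1)} {u v : D n} {h} (hu : u = cut false f)
    (hv : v = cut true f) : glue u v h = f := by
  subst hu hv; exact glue_cut f _

abbrev T (n : ℕ) : Type :=
  Σ p : {p : D n × D n // p.1 ≤ p.2},
    Σ a : Set.Icc p.val.1 p.val.2, Σ b : Set.Icc p.val.1 p.val.2, Σ c : Set.Icc p.val.1 p.val.2,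
      (Set.Icc ((a : D n) ⊔ c) p.val.2 × Set.Icc ((c : D n) ⊔ b) p.val.2) ×
        Set.Icc ((b : D n) ⊔ a) p.val.2

def toT {n : ℕ} (f : D (n+3)) : T n :=
  ⟨⟨(cut false (cut false (cut false f)), cut true (cut true (cut true f))),
      ((cut_le _).trans (cut_mono _ ((cut_le _).trans (cut_mono _ (cut_le _)))))⟩,
    ⟨cut false (cut false (cut true f)),
      cut_mono _ (cut_mono _ (cut_le _)), (cut_le _).trans (cut_mono _ (cut_le _))⟩,
    ⟨cut false (cut true (cut false f)),
      cut_mono _ (cut_le _), (cut_le _).trans (cut_mono _ (cut_mono _ (cut_le _)))⟩,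
    ⟨cut true (cut false (cut false f)),
      cut_le _, (cut_mono _ ((cut_le _).trans (cut_mono _ (cut_le _))))⟩,
    (⟨cut true (cut false (cut true f)),
      sup_le (cut_le _) (cut_mono _ (cut_mono _ (cut_le _))), cut_mono _ (cut_le _)⟩,
     ⟨cut true (cut true (cut false f)),
      sup_le (cut_mono _ (cut_le _)) (cut_le _), cut_mono _ (cut_mono _ (cut_le _))⟩),
     ⟨cut false (cut true (cut true f)),
      sup_le (cut_mono _ (cut_mono _ (cut_le _))) (cut_mono _ (cut_le _)), cut_le _⟩⟩

def ofT {n : ℕ} : T n → D (n+3)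
  | ⟨⟨(x, y), _⟩, ⟨a, ha⟩, ⟨b, hb⟩, ⟨c, hc⟩, (⟨ac, hac⟩, ⟨cb, hcb⟩), ⟨ba, hba⟩⟩ =>
    glue
      (glue (glue x c hc.1) (glue b cb (le_sup_right.trans hcb.1))
        (glue_mono hb.1 (le_sup_left.trans hcb.1)))
      (glue (glue a ac (le_sup_left.trans hac.1)) (glue ba y hba.2)
        (glue_mono (le_sup_right.trans hba.1) hac.2))
      (glue_mono (glue_mono ha.1 (le_sup_right.trans hac.1))
        (glue_mono (le_sup_left.trans hba.1) hcb.2))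

theorem ofT_toT {n : ℕ} (f : D (n+3)) : ofT (toT f) = f := by
  simp only [toT, ofT, glue_cut]

theorem toT_ofT {n : ℕ} (t : T n) : toT (ofT t) = t := by
  obtain ⟨⟨⟨x, y⟩, _⟩, ⟨a, ha⟩, ⟨b, hb⟩, ⟨c, hc⟩, ⟨⟨ac, hac⟩, ⟨cb, hcb⟩⟩, ⟨ba, hba⟩⟩ := t
  rfl

def equivT (n : ℕ) : D (n+3) ≃ T n := ⟨toT, ofT, ofT_toT, toT_ofT⟩

end D

theorem dedekind_plus_three_matrix (n : ℕ) :
    d (n + 3) =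
      ∑ p : {p : D n × D n // p.1 ≤ p.2},
        Matrix.trace
          ((Matrix.of fun a b : Set.Icc p.val.1 p.val.2 =>
              Nat.card (Set.Icc ((a : D n) ⊔ b) p.val.2)) ^ 3) := by
  rw [d, Fintype.card_congr (D.equivT n)]
  simp only [Fintype.card_sigma, Fintype.card_prod]
  refine Finset.sum_congr rfl fun p _ => ?_
  simp only [Matrix.trace, Matrix.diag, pow_succ, pow_zero, one_mul, Matrix.mul_apply,
    Matrix.of_apply, Nat.card_eq_fintype_card, Finset.sum_mul]
end

section
/- For every natural number n, the (n+4)-th Dedekind number satisfies d (n+4) = ∑_{(x,y) : D n × D n, x ≤ y} ∑_{a,b,c,d,e,f ∈ Set.Icc x y} Nat.card (Set.Icc x (a⊓c⊓d)) · Nat.card (Set.Icc x (b⊓c⊓e)) · Nat.card (Set.Icc x (b⊓d⊓f)) · Nat.card (Set.Icc x (a⊓e⊓f)) · Nat.card (Set.Icc (b⊔c⊔d) y) · Nat.card (Set.Icc (a⊔c⊔e) y) · Nat.card (Set.Icc (a⊔d⊔f) y) · Nat.card (Set.Icc (b⊔e⊔f) y), where the outer sum ranges over all intervals [x, y] of D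 n and the inner sum over all 6-tuples of elements of the interval. -/
/-- Monotone 4-ary Boolean-indexed families. -/
def Mono4 {L : Type} [Lattice L] (g : Bool → Bool → Bool → Bool → L) : Prop :=
  ∀ x x' y y' z z' w w', x ≤ x' → y ≤ y' → z ≤ z' → w ≤ w' → g x y z w ≤ g x' y' z' w'

theorem Mono4.of_covers {L : Type} [Lattice L] {g : Bool → Bool → Bool → Bool → L}
    (h1 : ∀ y z w, g false y z w ≤ g true y z w)
    (h2 : ∀ x z w, g x false z w ≤ g x true z w)
    (h3 : ∀ x y w, g x y false w ≤ g x y true w)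
    (h4 : ∀ x y z, g x y z false ≤ g x y z true) : Mono4 g := by
  have key : ∀ k : Bool → L, k false ≤ k true → ∀ a b, a ≤ b → k a ≤ k b := by
    intro k hk a b hab
    cases a <;> cases b
    · exact le_rfl
    · exact hk
    · exact absurd hab (by decide)
    · exact le_rfl
  intro x x' y y' z z' w w' hx hy hz hw
  calc g x y z w ≤ g x' y z w := key (fun t => g t y z w) (h1 _ _ _) _ _ hx
    _ ≤ g x' y' z w := key (fun t => g x' t z w) (h2 _ _ _) _ _ hy
    _ ≤ g x' y' z' w := key (fun t => g x' y' t w) (h3 _ _ _) _ _ hz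
    _ ≤ g x' y' z' w' := key (fun t => g x' y' z' t) (h4 _ _ _) _ _ hw

/-- Monotone functions of `n + 4` variables as monotone families of elements of `D n`. -/
def splitEquiv (n : ℕ) : D (n + 4) ≃ {g : Bool → Bool → Bool → Bool → D n // Mono4 g} where
  toFun f := ⟨fun x y z w => ⟨fun t => f.1 (Fin.cons x (Fin.cons y (Fin.cons z (Fin.cons w t)))),
      fun t t' h => f.2 (by
        refine Fin.cons_le_cons.2 ⟨le_rfl, Fin.cons_le_cons.2 ⟨le_rfl, Fin.cons_le_cons.2
          ⟨le_rfl, Fin.cons_le_cons.2 ⟨le_rfl, h⟩⟩⟩⟩)⟩,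
    fun x x' y y' z z' w w' hx hy hz hw t => f.2 (by
        refine Fin.cons_le_cons.2 ⟨hx, Fin.cons_le_cons.2 ⟨hy, Fin.cons_le_cons.2
          ⟨hz, Fin.cons_le_cons.2 ⟨hw, le_rfl⟩⟩⟩⟩)⟩
  invFun g := ⟨fun s => (g.1 (s 0) (s 1) (s 2) (s 3)).1 (fun i => s i.succ.succ.succ.succ),
    fun s s' h => le_trans ((g.1 (s 0) (s 1) (s 2) (s 3)).2 (fun i => h i.succ.succ.succ.succ))
      (g.2 _ _ _ _ _ _ _ _ (h 0) (h 1) (h 2) (h 3) _)⟩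
  left_inv f := by
    apply Subtype.ext
    funext s
    show f.1 _ = f.1 s
    refine congrArg f.1 ?_
    funext i
    refine Fin.cases rfl (fun i => ?_) i
    refine Fin.cases rfl (fun i => ?_) i
    refine Fin.cases rfl (fun i => ?_) i
    refine Fin.cases rfl (fun i => ?_) i
    rfl
  right_inv g := by
    apply Subtype.ext
    funext x y z w
    apply Subtype.ext
    funext t
    rfl

/-- The type counted by the right-hand side. -/
abbrev BigSigma (L : Type) [Lattice L] : Type :=
  Σ p : {p : L × L // p.1 ≤ p.2},
  Σ a : Set.Icc p.val.1 p.val.2, Σ b : Set.Icc p.val.1 p.val.2,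
  Σ c : Set.Icc p.val.1 p.val.2, Σ dd : Set.Icc p.val.1 p.val.2,
  Σ e : Set.Icc p.val.1 p.val.2, Σ f : Set.Icc p.val.1 p.val.2,
    ((((((Set.Icc p.val.1 ((a : L) ⊓ c ⊓ dd) ×
    Set.Icc p.val.1 ((b : L) ⊓ c ⊓ e)) ×
    Set.Icc p.val.1 ((b : L) ⊓ dd ⊓ f)) ×
    Set.Icc p.val.1 ((a : L) ⊓ e ⊓ f)) ×
    Set.Icc ((b : L) ⊔ c ⊔ dd) p.val.2) ×
    Set.Icc ((a : L) ⊔ c ⊔ e) p.val.2) ×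
    Set.Icc ((a : L) ⊔ dd ⊔ f) p.val.2) ×
    Set.Icc ((b : L) ⊔ e ⊔ f) p.val.2

/-- Table of sixteen values. -/
def tab {L : Type} (x y a b c d e f A B C E P Q R S : L) : Bool → Bool → Bool → Bool → L
  | false, false, false, false => x
  | true, false, false, false => A
  | false, true, false, false => B
  | false, false, true, false => C
  | false, false, false, true => E
  | true, true, false, false => c
  | true, false, true, false => d
  | true, false, false, true => a
  | false, true, true, false => b
  | false, true, false, true => e
  | false, false, true, true => f
  | true, true, true, false => P
  | true, true, false, true => Q
  | true, false, true, true => R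
  | false, true, true, true => S
  | true, true, true, true => y

/-- Monotone families correspond to points of `BigSigma`. -/
def tabEquiv (L : Type) [Lattice L] :
    BigSigma L ≃ {g : Bool → Bool → Bool → Bool → L // Mono4 g} where
  toFun := fun ⟨p, a, b, c, dd, e, f, (((((((A, B), C), E), P), Q), R), S)⟩ =>
    ⟨tab p.1.1 p.1.2 a b c dd e f A B C E P Q R S, by
      obtain ⟨A, hA, hA'⟩ := A
      obtain ⟨B, hB, hB'⟩ := B
      obtain ⟨C, hC, hC'⟩ := C
      obtain ⟨E, hE, hE'⟩ := E
      obtain ⟨P, hP, hP'⟩ := P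
      obtain ⟨Q, hQ, hQ'⟩ := Q
      obtain ⟨R, hR, hR'⟩ := R
      obtain ⟨S, hS, hS'⟩ := S
      simp only [le_inf_iff, sup_le_iff] at hA' hB' hC' hE' hP hQ hR hS
      apply Mono4.of_covers <;> rintro (_ | _) (_ | _) (_ | _) <;> simp only [tab] <;> tauto⟩
  invFun := fun ⟨g, hg⟩ =>
    have h : ∀ x x' y y' z z' w w', x ≤ x' ∧ y ≤ y' ∧ z ≤ z' ∧ w ≤ w' →
      g x y z w ≤ g x' y' z' w' := fun _ _ _ _ _ _ _ _ k => hg _ _ _ _ _ _ _ _ k.1 k.2.1 k.2.2.1 k.2.2.2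
    ⟨⟨(g false false false false, g true true true true), h _ _ _ _ _ _ _ _ (by decide)⟩,
     ⟨g true false false true, h _ _ _ _ _ _ _ _ (by decide), h _ _ _ _ _ _ _ _ (by decide)⟩,
     ⟨g false true true false, h _ _ _ _ _ _ _ _ (by decide), h _ _ _ _ _ _ _ _ (by decide)⟩,
     ⟨g true true false false, h _ _ _ _ _ _ _ _ (by decide), h _ _ _ _ _ _ _ _ (by decide)⟩,
     ⟨g true false true false, h _ _ _ _ _ _ _ _ (by decide), h _ _ _ _ _ _ _ _ (by decide)⟩,
     ⟨g false true false true, h _ _ _ _ _ _ _ _ (by decide), h _ _ _ _ _ _ _ _ (by decide)⟩,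
     ⟨g false false true true, h _ _ _ _ _ _ _ _ (by decide), h _ _ _ _ _ _ _ _ (by decide)⟩,
     (((((((⟨g true false false false, h _ _ _ _ _ _ _ _ (by decide), le_inf (le_inf (h _ _ _ _ _ _ _ _ (by decide)) (h _ _ _ _ _ _ _ _ (by decide))) (h _ _ _ _ _ _ _ _ (by decide))⟩,
      ⟨g false true false false, h _ _ _ _ _ _ _ _ (by decide), le_inf (le_inf (h _ _ _ _ _ _ _ _ (by decide)) (h _ _ _ _ _ _ _ _ (by decide))) (h _ _ _ _ _ _ _ _ (by decide))⟩),
      ⟨g false false true false, h _ _ _ _ _ _ _ _ (by decide), le_inf (le_inf (h _ _ _ _ _ _ _ _ (by decide)) (h _ _ _ _ _ _ _ _ (by decide))) (h _ _ _ _ _ _ _ _ (by decide))⟩),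
      ⟨g false false false true, h _ _ _ _ _ _ _ _ (by decide), le_inf (le_inf (h _ _ _ _ _ _ _ _ (by decide)) (h _ _ _ _ _ _ _ _ (by decide))) (h _ _ _ _ _ _ _ _ (by decide))⟩),
      ⟨g true true true false, sup_le (sup_le (h _ _ _ _ _ _ _ _ (by decide)) (h _ _ _ _ _ _ _ _ (by decide))) (h _ _ _ _ _ _ _ _ (by decide)), h _ _ _ _ _ _ _ _ (by decide)⟩),
      ⟨g true true false true, sup_le (sup_le (h _ _ _ _ _ _ _ _ (by decide)) (h _ _ _ _ _ _ _ _ (by decide))) (h _ _ _ _ _ _ _ _ (by decide)), h _ _ _ _ _ _ _ _ (by decide)⟩),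
      ⟨g true false true true, sup_le (sup_le (h _ _ _ _ _ _ _ _ (by decide)) (h _ _ _ _ _ _ _ _ (by decide))) (h _ _ _ _ _ _ _ _ (by decide)), h _ _ _ _ _ _ _ _ (by decide)⟩),
      ⟨g false true true true, sup_le (sup_le (h _ _ _ _ _ _ _ _ (by decide)) (h _ _ _ _ _ _ _ _ (by decide))) (h _ _ _ _ _ _ _ _ (by decide)), h _ _ _ _ _ _ _ _ (by decide)⟩)⟩
  left_inv := by
    rintro ⟨p, a, b, c, dd, e, f, ⟨⟨⟨⟨⟨⟨⟨A, B⟩, C⟩, E⟩, P⟩, Q⟩, R⟩, S⟩⟩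
    rfl
  right_inv := by
    rintro ⟨g, hg⟩
    apply Subtype.ext
    funext x y z w
    cases x <;> cases y <;> cases z <;> cases w <;> rfl

theorem dedekind_plus_four_third (n : ℕ) :
    d (n + 4) =
      ∑ p : {p : D n × D n // p.1 ≤ p.2},
        ∑ a : Set.Icc p.val.1 p.val.2, ∑ b : Set.Icc p.val.1 p.val.2,
        ∑ c : Set.Icc p.val.1 p.val.2, ∑ dd : Set.Icc p.val.1 p.val.2,
        ∑ e : Set.Icc p.val.1 p.val.2, ∑ f : Set.Icc p.val.1 p.val.2,
          Nat.card (Set.Icc p.val.1 ((a : D n) ⊓ c ⊓ dd)) *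
          Nat.card (Set.Icc p.val.1 ((b : D n) ⊓ c ⊓ e)) *
          Nat.card (Set.Icc p.val.1 ((b : D n) ⊓ dd ⊓ f)) *
          Nat.card (Set.Icc p.val.1 ((a : D n) ⊓ e ⊓ f)) *
          Nat.card (Set.Icc ((b : D n) ⊔ c ⊔ dd) p.val.2) *
          Nat.card (Set.Icc ((a : D n) ⊔ c ⊔ e) p.val.2) *
          Nat.card (Set.Icc ((a : D n) ⊔ dd ⊔ f) p.val.2) *
          Nat.card (Set.Icc ((b : D n) ⊔ e ⊔ f) p.val.2) := by
  have e := Nat.card_congr ((splitEquiv n).trans (tabEquiv (D n)).symm)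
  rw [d, ← Nat.card_eq_fintype_card, e]
  simp only [Nat.card_sigma, Nat.card_prod]
end
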